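/- Let K be a field of characteristic zero, let ρ be a K-linear representation of the symmetric group Σ_n on a finite-dimensional K-vector space U with character χ (χ(σ) = trace ρ(σ)), let W be a finite-dimensional K-vector space and f : W → W a K-linear endomorphism. Let Σ_n act diagonally on U ⊗ W^{⊗n} by σ ↦ ρ(σ) ⊗ P_σ, and let S := (U ⊗ W^{⊗n})^{Σ_n} be the invariant subspace. Then id_U ⊗ f^{⊗n} maps S into itself and trace( (id_U ⊗ f^{⊗n})|_S ) = (1/n!) · ∑_{σ ∈ Σ_n} χ(σ) · ∏_{cycles c of σ, fixed points counted as 1-cycles} trace(f^{length(c)}). Equivalently, grouping permutations by cycle type, this equals ∑_{λ = (k_1,k_2,…) ⊢ n} (χ_λ / z_λ) · ∏_{r≥1} trace(f^r)^{k_r}, where χ_λ is the (constant) value of χ on permutations of cycle type λ. (This is Theorem 2.2 of the paper — the twisting formula for Schur objects — instantiated at finite-dimensional vector spaces with endomorphism.) -/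

import Mathlib

/-- The permutation operator `P_σ` on the `n`-fold tensor power `W^{⊗n}`. -/
noncomputable def permMap (K W : Type*) [CommRing K] [AddCommGroup W] [Module K W]
    {n : ℕ} (σ : Equiv.Perm (Fin n)) :
    (PiTensorProduct K fun _ : Fin n => W) →ₗ[K] PiTensorProduct K fun _ : Fin n => W :=
  (PiTensorProduct.reindex K (fun _ : Fin n => W) σ).toLinearMap

/-- The invariants of the diagonal `Σ_n`-action `σ ↦ ρ(σ) ⊗ P_σ` on `U ⊗ W^{⊗n}`. -/
noncomputable def diagFix (K : Type*) [Field K] {U W : Type*} [AddCommGroup U] [Module K U]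
    [AddCommGroup W] [Module K W] {n : ℕ} (ρ : Representation K (Equiv.Perm (Fin n)) U) :
    Submodule K (TensorProduct K U (PiTensorProduct K fun _ : Fin n => W)) where
  carrier := {x | ∀ σ : Equiv.Perm (Fin n), TensorProduct.map (ρ σ) (permMap K W σ) x = x}
  zero_mem' := by intro σ; simp
  add_mem' := by intro a b ha hb σ; simp [map_add, ha σ, hb σ]
  smul_mem' := by intro c x hx σ; simp [map_smul, hx σ]

section

open Finset

namespace Matrix

variable {R ι : Type*} [CommSemiring R] [Fintype ι]

/-- An entry of a power of a matrix as a sum over paths. -/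
theorem pow_succ_apply_eq_sum_prod [DecidableEq ι] (A : Matrix ι ι R) (N : ℕ) (x y : ι) :
    (A ^ (N + 1)) x y = ∑ φ : Fin N → ι, ∏ i : Fin (N + 1),
      A (Fin.cons (α := fun _ => ι) x φ i) (Fin.snoc (α := fun _ => ι) φ y i) := by
  induction N generalizing x with
  | zero => simp [Fin.snoc]
  | succ N ih =>
    rw [pow_succ', mul_apply, ← (Fin.consEquiv fun _ => ι).sum_comp, Fintype.sum_prod_type]
    refine sum_congr rfl fun z _ => ?_
    rw [ih, mul_sum]
    refine sum_congr rfl fun φ _ => ?_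
    rw [Fin.prod_univ_succ (n := N + 1)]
    simp [Fin.consEquiv, ← Fin.cons_snoc_eq_snoc_cons]

/-- The sum over all colourings `φ : α → ι` of the weight `∏ i, A (φ i) (φ (σ i))`. -/
def permWeight (A : Matrix ι ι R) {α : Type*} [Fintype α] [DecidableEq α]
    (σ : Equiv.Perm α) : R :=
  ∑ φ : α → ι, ∏ i, A (φ i) (φ (σ i))

theorem permWeight_finRotate [DecidableEq ι] (A : Matrix ι ι R) (N : ℕ) :
    A.permWeight (finRotate (N + 1)) = (A ^ (N + 1)).trace := by
  rw [permWeight, trace, ← (Fin.consEquiv fun _ => ι).sum_comp, Fintype.sum_prod_type]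
  refine sum_congr rfl fun x _ => ?_
  rw [diag_apply, pow_succ_apply_eq_sum_prod]
  simp [Fin.snoc_eq_cons_rotate, Fin.consEquiv]

variable {α β : Type*} [Fintype α] [DecidableEq α] [Fintype β] [DecidableEq β]

theorem permWeight_sumCongr (A : Matrix ι ι R) (σ : Equiv.Perm α) (τ : Equiv.Perm β) :
    A.permWeight (Equiv.Perm.sumCongr σ τ) = A.permWeight σ * A.permWeight τ := by
  rw [permWeight, permWeight, permWeight, Fintype.sum_mul_sum, ← Fintype.sum_prod_type',
    ← (Equiv.sumArrowEquivProdArrow α β ι).symm.sum_comp]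
  simp [Equiv.sumArrowEquivProdArrow]

theorem permWeight_permCongr (A : Matrix ι ι R) (e : α ≃ β) (σ : Equiv.Perm α) :
    A.permWeight (e.permCongr σ) = A.permWeight σ := by
  rw [permWeight, permWeight, ← (e.arrowCongr (Equiv.refl ι)).sum_comp]
  refine sum_congr rfl fun φ _ => ?_
  rw [← e.prod_comp]
  simp

end Matrix

namespace Equiv.Perm

variable {α β : Type*} [Fintype α] [DecidableEq α] [Fintype β] [DecidableEq β]

theorem cycleType_viaFintypeEmbedding (σ : Perm α) (f : α ↪ β) :
    (σ.viaFintypeEmbedding f).cycleType = σ.cycleType :=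
  cycleType_extendDomain _

theorem cycleType_permCongr (e : α ≃ β) (σ : Perm α) :
    (e.permCongr σ).cycleType = σ.cycleType := by
  rw [← cycleType_viaFintypeEmbedding σ e.toEmbedding]
  congr 1
  ext b
  obtain ⟨a, rfl⟩ := e.surjective b
  have := viaFintypeEmbedding_apply_image σ e.toEmbedding a
  simp_all

theorem cycleType_sumCongr (σ : Perm α) (τ : Perm β) :
    (sumCongr σ τ).cycleType = σ.cycleType + τ.cycleType := by
  have hσ : sumCongr σ (1 : Perm β) = σ.viaFintypeEmbedding Function.Embedding.inl := by
    ext (a | b)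
    · exact (viaFintypeEmbedding_apply_image σ (Function.Embedding.inl (β := β)) a).symm
    · rw [viaFintypeEmbedding_apply_notMem_range _ _ (by simp)]; rfl
  have hτ : sumCongr (1 : Perm α) τ = τ.viaFintypeEmbedding Function.Embedding.inr := by
    ext (a | b)
    · rw [viaFintypeEmbedding_apply_notMem_range _ _ (by simp)]; rfl
    · exact (viaFintypeEmbedding_apply_image τ (Function.Embedding.inr (α := α)) b).symm
  have hd : Disjoint (sumCongr σ (1 : Perm β)) (sumCongr (1 : Perm α) τ) := by
    rintro (a | b) <;> simp
  have hmul : sumCongr σ τ = sumCongr σ 1 * sumCongr 1 τ := by simp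
  rw [hmul, hd.cycleType_mul, hσ, hτ, cycleType_viaFintypeEmbedding,
    cycleType_viaFintypeEmbedding]

theorem parts_partition_sumCongr (σ : Perm α) (τ : Perm β) :
    (sumCongr σ τ).partition.parts = σ.partition.parts + τ.partition.parts := by
  have hσ := σ.support.card_le_univ
  have hτ := τ.support.card_le_univ
  rw [parts_partition, parts_partition, parts_partition, ← sum_cycleType, cycleType_sumCongr,
    Multiset.sum_add, sum_cycleType, sum_cycleType, Fintype.card_sum,
    show Fintype.card α + Fintype.card β - (#σ.support + #τ.support) =
      (Fintype.card α - #σ.support) + (Fintype.card β - #τ.support) by omega,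
    Multiset.replicate_add]
  abel

theorem parts_partition_finRotate (N : ℕ) :
    (finRotate (N + 1)).partition.parts = {N + 1} := by
  cases N with
  | zero =>
    have h : finRotate 1 = 1 := Subsingleton.elim _ _
    rw [parts_partition, h]
    simp
  | succ N => simp [parts_partition, cycleType_finRotate, support_finRotate]

variable {R ι : Type*} [CommSemiring R] [Fintype ι] [DecidableEq ι]

theorem exists_parts_partition_eq_and_permWeight_eq (A : Matrix ι ι R) (m : Multiset ℕ)
    (hm : ∀ r ∈ m, 0 < r) :
    ∃ (N : ℕ) (σ : Perm (Fin N)), σ.partition.parts = m ∧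
      A.permWeight σ = (m.map fun r => (A ^ r).trace).prod := by
  induction m using Multiset.induction with
  | empty => exact ⟨0, 1, by simp [parts_partition], by simp [Matrix.permWeight]⟩
  | cons r m ih =>
    obtain ⟨N, σ, hσ, hw⟩ := ih fun s hs => hm s (Multiset.mem_cons_of_mem hs)
    obtain ⟨k, rfl⟩ := Nat.exists_eq_succ_of_ne_zero (hm r (Multiset.mem_cons_self r m)).ne'
    refine ⟨k + 1 + N, finSumFinEquiv.permCongr (sumCongr (finRotate (k + 1)) σ), ?_, ?_⟩
    · have h := parts_partition_sumCongr (finRotate (k + 1)) σ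
      rw [parts_partition_finRotate, hσ, parts_partition, ← sum_cycleType] at h
      rw [parts_partition, ← sum_cycleType, cycleType_permCongr,
        ← Fintype.card_congr (finSumFinEquiv (m := k + 1) (n := N)), h]
      simp
    · rw [Matrix.permWeight_permCongr, Matrix.permWeight_sumCongr,
        Matrix.permWeight_finRotate, hw]
      simp

theorem permWeight_eq_prod_trace_pow (A : Matrix ι ι R) (σ : Perm α) :
    A.permWeight σ = (σ.partition.parts.map fun r => (A ^ r).trace).prod := by
  obtain ⟨N, τ, hτ, hw⟩ := exists_parts_partition_eq_and_permWeight_eq A σ.partition.parts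
    fun _ h => σ.partition.parts_pos h
  have hcard : Fintype.card (Fin N) = Fintype.card α := by
    rw [← τ.partition.parts_sum, ← σ.partition.parts_sum, hτ]
  let e := Fintype.equivOfCardEq hcard
  have hconj : IsConj (e.permCongr τ) σ := by
    rw [isConj_iff_cycleType_eq, cycleType_permCongr, ← filter_parts_partition_eq_cycleType, hτ,
      filter_parts_partition_eq_cycleType]
  obtain ⟨π, hπ⟩ := isConj_iff.1 hconj
  rw [← hw, ← Matrix.permWeight_permCongr A e τ, ← Matrix.permWeight_permCongr A π (e.permCongr τ), ← hπ]
  congr 1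

end Equiv.Perm

theorem trace_piTensorProduct_map_comp_permMap {K W : Type*} [Field K] [AddCommGroup W]
    [Module K W] [FiniteDimensional K W] {n : ℕ} (σ : Equiv.Perm (Fin n)) (f : W →ₗ[K] W) :
    LinearMap.trace K _ ((PiTensorProduct.map fun _ : Fin n => f) ∘ₗ permMap K W σ) =
      LinearMap.trace K W f ^ (n - σ.support.card) *
        (σ.cycleType.map fun r => LinearMap.trace K W (f ^ r)).prod := by
  classical
  let b := Module.finBasis K W
  let A := LinearMap.toMatrix b b f
  have htrace (r : ℕ) : LinearMap.trace K W (f ^ r) = (A ^ r).trace := by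
    rw [LinearMap.trace_eq_matrix_trace K b, LinearMap.toMatrix_pow]
  have hweight : LinearMap.trace K _ ((PiTensorProduct.map fun _ : Fin n => f) ∘ₗ permMap K W σ) =
      A.permWeight σ⁻¹ := by
    rw [LinearMap.trace_eq_matrix_trace K (Basis.piTensorProduct fun _ : Fin n => b),
      Matrix.trace, Matrix.permWeight]
    refine sum_congr rfl fun φ _ => ?_
    rw [Matrix.diag_apply, LinearMap.toMatrix_apply, Basis.piTensorProduct_apply,
      LinearMap.comp_apply]
    have h : permMap K W σ (PiTensorProduct.tprod K fun i => b (φ i)) =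
        PiTensorProduct.tprod K fun i => b (φ (σ⁻¹ i)) :=
      PiTensorProduct.reindex_tprod _ _
    rw [h, PiTensorProduct.map_tprod, Basis.piTensorProduct_repr_tprod_apply]
    simp [A, LinearMap.toMatrix_apply]
  rw [hweight, Equiv.Perm.permWeight_eq_prod_trace_pow, Equiv.Perm.parts_partition]
  simp [← htrace, mul_comm]

theorem LinearMap.trace_restrict_eq_trace_comp_of_isProj {K V : Type*} [Field K]
    [AddCommGroup V] [Module K V] [FiniteDimensional K V] {p : Submodule K V} {e : V →ₗ[K] V}
    (he : LinearMap.IsProj p e) (T : V →ₗ[K] V) (hT : ∀ x ∈ p, T x ∈ p) :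
    LinearMap.trace K p (T.restrict hT) = LinearMap.trace K V (T ∘ₗ e) := by
  have h₁ : T.restrict hT = (e.codRestrict p he.map_mem) ∘ₗ (T ∘ₗ p.subtype) := by
    ext x
    simp [he.map_id _ (hT x x.2)]
  have h₂ : T ∘ₗ e = (T ∘ₗ p.subtype) ∘ₗ (e.codRestrict p he.map_mem) := by
    ext x
    simp
  rw [h₁, h₂, LinearMap.trace_comp_comm']

/-- The diagonal action `σ ↦ ρ(σ) ⊗ P_σ` on `U ⊗ W^{⊗n}`. -/
noncomputable def diagRep {K U : Type*} (W : Type*) [Field K] [AddCommGroup U] [Module K U]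
    [AddCommGroup W] [Module K W] {n : ℕ} (ρ : Representation K (Equiv.Perm (Fin n)) U) :
    Representation K (Equiv.Perm (Fin n))
      (TensorProduct K U (PiTensorProduct K fun _ : Fin n => W)) where
  toFun σ := TensorProduct.map (ρ σ) (permMap K W σ)
  map_one' := by
    have h : permMap K W (1 : Equiv.Perm (Fin n)) = LinearMap.id := by
      ext x
      simp [permMap]
      rfl
    rw [h, map_one, Module.End.one_eq_id, TensorProduct.map_id]
    rfl
  map_mul' σ τ := by
    have h : permMap K W (σ * τ) = permMap K W σ ∘ₗ permMap K W τ := by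
      ext x
      simp only [LinearMap.compMultilinearMap_apply, LinearMap.comp_apply]
      simp [permMap, PiTensorProduct.reindex_tprod]
      rfl
    rw [h, map_mul, Module.End.mul_eq_comp, TensorProduct.map_comp]
    rfl

end

/-- The abstract twisting formula (Theorem 2.2 of the paper) for finite-dimensional vector
spaces with an endomorphism: the trace of `id_U ⊗ f^{⊗n}` on the invariants of the diagonal
action is `(1/n!) ∑_σ χ(σ) ∏_{cycles c of σ} trace (f^{length c})`. -/
theorem stmt9 (K : Type*) [Field K] [CharZero K] {U W : Type*}
    [AddCommGroup U] [Module K U] [FiniteDimensional K U]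
    [AddCommGroup W] [Module K W] [FiniteDimensional K W]
    (n : ℕ) (ρ : Representation K (Equiv.Perm (Fin n)) U) (f : W →ₗ[K] W) :
    ∃ hf : ∀ x ∈ diagFix K ρ,
        (TensorProduct.map (LinearMap.id (R := K) (M := U))
          (PiTensorProduct.map fun _ : Fin n => f)) x ∈ diagFix K ρ,
      LinearMap.trace K (diagFix K ρ)
          ((TensorProduct.map (LinearMap.id (R := K) (M := U))
            (PiTensorProduct.map fun _ : Fin n => f)).restrict hf) =
        (n.factorial : K)⁻¹ *
          ∑ σ : Equiv.Perm (Fin n),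
            LinearMap.trace K U (ρ σ) *
              (LinearMap.trace K W f ^ (n - σ.support.card) *
                (σ.cycleType.map fun r => LinearMap.trace K W (f ^ r)).prod) := by
  have hf : ∀ x ∈ diagFix K ρ,
      (TensorProduct.map (LinearMap.id (R := K) (M := U))
        (PiTensorProduct.map fun _ : Fin n => f)) x ∈ diagFix K ρ := by
    intro x hx σ
    have hcomm : permMap K W σ ∘ₗ (PiTensorProduct.map fun _ : Fin n => f) =
        (PiTensorProduct.map fun _ : Fin n => f) ∘ₗ permMap K W σ :=
      (PiTensorProduct.map_comp_reindex_eq (fun _ : Fin n => f) σ).symm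
    conv_rhs => rw [← hx σ]
    rw [← LinearMap.comp_apply, ← LinearMap.comp_apply, ← TensorProduct.map_comp,
      ← TensorProduct.map_comp, hcomm, LinearMap.comp_id, LinearMap.id_comp]
  refine ⟨hf, ?_⟩
  have hcard : (Fintype.card (Equiv.Perm (Fin n)) : K) = n.factorial := by
    rw [Fintype.card_perm, Fintype.card_fin]
  have hne : (Fintype.card (Equiv.Perm (Fin n)) : K) ≠ 0 := by
    rw [hcard]
    exact_mod_cast n.factorial_ne_zero
  let _ : Invertible (Fintype.card (Equiv.Perm (Fin n)) : K) := invertibleOfNonzero hne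
  have hproj : LinearMap.IsProj (diagFix K ρ) (diagRep W ρ).averageMap :=
    (diagRep W ρ).isProj_averageMap
  have havg : (diagRep W ρ).averageMap =
      (n.factorial : K)⁻¹ • ∑ σ, TensorProduct.map (ρ σ) (permMap K W σ) := by
    rw [Representation.averageMap, GroupAlgebra.average, map_smul, map_sum, invOf_eq_inv, hcard]
    simp [diagRep]
  rw [LinearMap.trace_restrict_eq_trace_comp_of_isProj hproj, havg, LinearMap.comp_smul, map_smul,
    smul_eq_mul, ← Module.End.mul_eq_comp, Finset.mul_sum, map_sum]
  congr 1
  refine Finset.sum_congr rfl fun σ _ => ?_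
  rw [Module.End.mul_eq_comp, ← TensorProduct.map_comp, LinearMap.id_comp, LinearMap.trace_tensorProduct',
    trace_piTensorProduct_map_comp_permMap]
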